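/- Let (X, 𝒜, μ) be a σ-finite measure space, let p : X → ℝ≥0 be a probability density with respect to μ (i.e. ∫ p dμ = 1), and let l : X → ℝ≥0 be measurable with Z := ∫ l·p dμ satisfying 0 < Z < ∞. Then for every probability density q : X → ℝ≥0 with respect to μ such that q(x) > 0 for μ-a.e. x with l(x)·p(x) > 0, the second moment of the importance weight w := l·p/q under the measure with density q satisfies ∫ (l·p/q)²·q dμ ≥ Z², and hence the variance of w under q·μ is at least 0 = Z² − Z², with equality (variance zero) if and only if q = l·p/Z μ-almost everywhere on {l·p > 0}. In particular, the density q* := l·p/Z minimizes the variance of the unnormalized importance weight over all admissible proposal densities q. -/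

import Mathlib

open MeasureTheory ENNReal NNReal

/-- Arithmetic–geometric mean inequality for the importance weight `f / q`. -/
theorem NNReal.two_mul_le_div_sq_mul_add (z f q : ℝ≥0) (h : 0 < f → 0 < q) :
    2 * z * f ≤ (f / q) ^ 2 * q + z ^ 2 * q := by
  rcases eq_or_ne f 0 with rfl | hf
  · simp
  have hq : q ≠ 0 := (h (pos_iff_ne_zero.2 hf)).ne'
  calc 2 * z * f = 2 * z * (f / q) * q := by field_simp
    _ ≤ (z ^ 2 + (f / q) ^ 2) * q := by gcongr; exact two_mul_le_add_sq z (f / q)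
    _ = (f / q) ^ 2 * q + z ^ 2 * q := by ring

theorem NNReal.eq_div_of_two_mul_eq_div_sq_mul_add {z f q : ℝ≥0} (hz : 0 < z) (hq : 0 < q)
    (h : 2 * z * f = (f / q) ^ 2 * q + z ^ 2 * q) : q = f / z := by
  obtain ⟨w, rfl⟩ : ∃ w, f = w * q := ⟨f / q, by field_simp⟩
  rw [mul_div_cancel_right₀ _ hq.ne'] at h
  have h' : 2 * z * w = w ^ 2 + z ^ 2 :=
    mul_right_cancel₀ hq.ne' (by linear_combination h)
  have hw : w = z := by
    rw [← NNReal.coe_inj] at h' ⊢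
    push_cast at h'
    have : ((w : ℝ) - z) ^ 2 = 0 := by linear_combination -h'
    exact sub_eq_zero.1 (pow_eq_zero_iff two_ne_zero |>.1 this)
  rw [hw]
  field_simp

/-- Proposition 1: the posterior-proportional proposal `q* = l·p/Z` minimises the variance of
the unnormalised importance weight `w = l·p/q`.  The second moment of `w` under the proposal
measure `q·μ` is at least `Z²` (hence the variance is at least `0`), with equality iff
`q = l·p/Z` a.e. on `{l·p > 0}`; and the optimal proposal attains second moment exactly `Z²`. -/
theorem optimal_importance_distribution
    {X : Type*} [MeasurableSpace X] (μ : Measure X) [SigmaFinite μ]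
    (p q l : X → ℝ≥0) (hp : Measurable p) (hq : Measurable q) (hl : Measurable l)
    (hp1 : ∫⁻ x, (p x : ℝ≥0∞) ∂μ = 1) (hq1 : ∫⁻ x, (q x : ℝ≥0∞) ∂μ = 1)
    (Z : ℝ≥0∞) (hZ : Z = ∫⁻ x, (l x : ℝ≥0∞) * (p x : ℝ≥0∞) ∂μ)
    (hZ0 : 0 < Z) (hZtop : Z < ∞)
    (hqpos : ∀ᵐ x ∂μ, 0 < l x * p x → 0 < q x) :
    Z ^ 2 ≤ ∫⁻ x, ((l x * p x / q x : ℝ≥0) : ℝ≥0∞) ^ 2 * (q x : ℝ≥0∞) ∂μ ∧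
    ((∫⁻ x, ((l x * p x / q x : ℝ≥0) : ℝ≥0∞) ^ 2 * (q x : ℝ≥0∞) ∂μ) = Z ^ 2 ↔
      ∀ᵐ x ∂μ, 0 < l x * p x → (q x : ℝ≥0∞) = (l x : ℝ≥0∞) * (p x : ℝ≥0∞) / Z) ∧
    (∫⁻ x, ((l x : ℝ≥0∞) * (p x : ℝ≥0∞) / ((l x : ℝ≥0∞) * (p x : ℝ≥0∞) / Z)) ^ 2
        * ((l x : ℝ≥0∞) * (p x : ℝ≥0∞) / Z) ∂μ) = Z ^ 2 := by
  lift Z to ℝ≥0 using hZtop.ne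
  have hz : 0 < Z := by exact_mod_cast hZ0
  have hfm : Measurable fun x ↦ (l x : ℝ≥0∞) * (p x : ℝ≥0∞) := by fun_prop
  set I := ∫⁻ x, ((l x * p x / q x : ℝ≥0) : ℝ≥0∞) ^ 2 * (q x : ℝ≥0∞) ∂μ with hI
  set F : X → ℝ≥0∞ := fun x ↦ 2 * Z * ((l x : ℝ≥0∞) * (p x : ℝ≥0∞)) with hF
  set G : X → ℝ≥0∞ := fun x ↦
    ((l x * p x / q x : ℝ≥0) : ℝ≥0∞) ^ 2 * (q x : ℝ≥0∞) + (Z : ℝ≥0∞) ^ 2 * (q x : ℝ≥0∞) with hG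
  have hGm : Measurable G := by fun_prop
  have hFint : ∫⁻ x, F x ∂μ = (Z : ℝ≥0∞) ^ 2 + (Z : ℝ≥0∞) ^ 2 := by
    rw [hF, lintegral_const_mul _ hfm, ← hZ]
    ring
  have hGint : ∫⁻ x, G x ∂μ = I + (Z : ℝ≥0∞) ^ 2 := by
    rw [hG, lintegral_add_right _ (by fun_prop), lintegral_const_mul _ (by fun_prop), hq1, mul_one]
  have hFG : F ≤ᵐ[μ] G := by
    filter_upwards [hqpos] with x hx
    simp only [hF, hG]
    exact_mod_cast NNReal.two_mul_le_div_sq_mul_add Z (l x * p x) (q x) hx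
  refine ⟨?_, ⟨fun h ↦ ?_, fun h ↦ ?_⟩, ?_⟩
  · have := lintegral_mono_ae hFG
    rw [hFint, hGint] at this
    exact (ENNReal.add_le_add_iff_right (by finiteness)).1 this
  · have hae : F =ᵐ[μ] G := by
      refine ae_eq_of_ae_le_of_lintegral_le hFG ?_ hGm.aemeasurable ?_
      · rw [hFint]
        finiteness
      · rw [hFint, hGint, h]
    filter_upwards [hae, hqpos] with x hx hqx hfx
    simp only [hF, hG] at hx
    have := NNReal.eq_div_of_two_mul_eq_div_sq_mul_add hz (hqx hfx) (f := l x * p x)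
      (by exact_mod_cast hx)
    rw [← ENNReal.coe_mul, ← ENNReal.coe_div hz.ne']
    exact_mod_cast this
  · rw [sq, hI]
    nth_rw 2 [hZ]
    rw [← lintegral_const_mul _ hfm]
    refine lintegral_congr_ae ?_
    filter_upwards [h] with x hx
    rw [← ENNReal.coe_mul] at hx ⊢
    rw [← ENNReal.coe_div hz.ne', ENNReal.coe_inj] at hx
    rcases eq_or_ne (l x * p x) 0 with h0 | h0
    · simp [h0]
    · rw [hx (pos_iff_ne_zero.2 h0)]
      norm_cast
      field_simp
  · rw [sq]
    nth_rw 4 [hZ]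
    rw [← lintegral_const_mul _ hfm]
    refine lintegral_congr fun x ↦ ?_
    rw [← ENNReal.coe_mul, ← ENNReal.coe_div hz.ne']
    rcases eq_or_ne (l x * p x) 0 with h0 | h0
    · simp [h0]
    · rw [← ENNReal.coe_div (div_ne_zero h0 hz.ne')]
      norm_cast
      field_simp
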